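/- arXiv:2104.02823 — 4 statements merged into one kernel-verified Lean document; each statement's English description precedes it below -/
import Mathlib

section
/- Assume f is continuous and (x^k, d^k, α_k) is an Algorithm-2.1 sequence such that f(x^k) > f_target for all k ∈ ℕ. Then lim_{k→∞} α_k² (f(x^k) − f_target) = 0. -/
open Filter Topology

/-- A nonnegative sequence dominated by the decrements of a sequence bounded below, up to summable
errors, is summable. -/
theorem summable_of_le_sub_succ_add {a F η : ℕ → ℝ} {m : ℝ} (ha : ∀ k, 0 ≤ a k)
    (hF : ∀ k, m ≤ F k) (hη : ∀ k, 0 ≤ η k) (hηsum : Summable η)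
    (h : ∀ k, a k ≤ F k - F (k + 1) + η k) : Summable a := by
  refine summable_of_sum_range_le (c := F 0 - m + ∑' k, η k) ha fun N => ?_
  calc ∑ k ∈ Finset.range N, a k
      ≤ ∑ k ∈ Finset.range N, (F k - F (k + 1) + η k) := Finset.sum_le_sum fun k _ => h k
    _ = F 0 - F N + ∑ k ∈ Finset.range N, η k := by
      rw [Finset.sum_add_distrib, Finset.sum_range_sub']
    _ ≤ F 0 - m + ∑' k, η k :=
      add_le_add (sub_le_sub_left (hF N) _) (hηsum.sum_le_tsum _ fun k _ => hη k)

/-- Lemma 2.2 (first part): for an Algorithm-2.1 sequence with `f(xᵏ) > f_target`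
for all `k`, one has `αₖ² (f(xᵏ) − f_target) → 0`. -/
theorem alg21_product_tendsto_zero
    (n : ℕ) (Ω : Set (EuclideanSpace ℝ (Fin n))) (hΩc : IsClosed Ω) (hΩconv : Convex ℝ Ω)
    (f : EuclideanSpace ℝ (Fin n) → ℝ) (hf : Continuous f)
    (ftarget Δ γ : ℝ) (hΔ : 0 < Δ) (hγ : γ ∈ Set.Ioo (0 : ℝ) 1)
    (η : ℕ → ℝ) (hηpos : ∀ k, 0 < η k) (hηsum : Summable η)
    (x d : ℕ → EuclideanSpace ℝ (Fin n)) (α : ℕ → ℝ)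
    (hxΩ : ∀ k, x k ∈ Ω)
    (hd : ∀ k, ‖d k‖ ≤ Δ) (hdΩ : ∀ k, x k + d k ∈ Ω)
    (hα : ∀ k, α k ∈ Set.Ioc (0 : ℝ) 1)
    (hdec : ∀ k, f (x k + α k • d k) ≤
      f (x k) + η k - γ * (α k) ^ 2 * (f (x k) - ftarget))
    (hrej : ∀ k, α k = 1 ∨
      f (x k + (2 * α k) • d k) >
        f (x k) + η k - γ * (2 * α k) ^ 2 * (f (x k) - ftarget))
    (hmono : ∀ k, f (x (k + 1)) ≤ f (x k + α k • d k))
    (htarget : ∀ k, ftarget < f (x k)) :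
    Tendsto (fun k => (α k) ^ 2 * (f (x k) - ftarget)) atTop (𝓝 0) := by
  have hsum : Summable fun k => γ * ((α k) ^ 2 * (f (x k) - ftarget)) := by
    refine summable_of_le_sub_succ_add (F := fun k => f (x k))
      (fun k => mul_nonneg hγ.1.le (mul_nonneg (sq_nonneg _) (sub_pos.2 (htarget k)).le))
      (fun k => (htarget k).le) (fun k => (hηpos k).le) hηsum fun k => ?_
    linarith [hdec k, hmono k]
  exact ((summable_mul_left_iff hγ.1.ne').1 hsum).tendsto_atTop_zero
end

section
/- Assume f is continuous and (x^k, d^k, α_k) is an Algorithm-2.1 sequence such that f(x^k) > f_target for all k ∈ ℕ. Then at least one of the following holds: (a) lim_{k→∞} α_k = 0; or (b) there exists a strictly increasing sequence of indices (k_j) such that lim_{j→∞} f(x^{k_j}) = f_target. -/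
open Filter Topology

/-- A nonnegative sequence whose decrease at each step is at least `b k` up to a summable
error has summable `b`. -/
theorem summable_of_le_add_sub {g η b : ℕ → ℝ} (hg : ∀ k, 0 ≤ g k) (hη : ∀ k, 0 ≤ η k)
    (hηsum : Summable η) (hb : ∀ k, 0 ≤ b k) (h : ∀ k, g (k + 1) ≤ g k + η k - b k) :
    Summable b := by
  have key : ∀ m, ∑ i ∈ Finset.range m, b i ≤ g 0 - g m + ∑ i ∈ Finset.range m, η i := by
    intro m
    induction m with
    | zero => simp
    | succ m ih =>
      rw [Finset.sum_range_succ, Finset.sum_range_succ]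
      linarith [h m]
  refine summable_of_sum_range_le (c := g 0 + ∑' i, η i) hb fun m => ?_
  linarith [key m, hg m, hηsum.sum_le_tsum (Finset.range m) fun i _ => hη i]

/-- Lemma 2.2 (second part): either `αₖ → 0` or `f(xᵏ) → f_target`
along a strictly increasing subsequence of indices. -/
theorem alg21_alpha_to_zero_or_subseq_to_target
    (n : ℕ) (Ω : Set (EuclideanSpace ℝ (Fin n))) (hΩc : IsClosed Ω) (hΩconv : Convex ℝ Ω)
    (f : EuclideanSpace ℝ (Fin n) → ℝ) (hf : Continuous f)
    (ftarget Δ γ : ℝ) (hΔ : 0 < Δ) (hγ : γ ∈ Set.Ioo (0 : ℝ) 1)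
    (η : ℕ → ℝ) (hηpos : ∀ k, 0 < η k) (hηsum : Summable η)
    (x d : ℕ → EuclideanSpace ℝ (Fin n)) (α : ℕ → ℝ)
    (hxΩ : ∀ k, x k ∈ Ω)
    (hd : ∀ k, ‖d k‖ ≤ Δ) (hdΩ : ∀ k, x k + d k ∈ Ω)
    (hα : ∀ k, α k ∈ Set.Ioc (0 : ℝ) 1)
    (hdec : ∀ k, f (x k + α k • d k) ≤
      f (x k) + η k - γ * (α k) ^ 2 * (f (x k) - ftarget))
    (hrej : ∀ k, α k = 1 ∨
      f (x k + (2 * α k) • d k) >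
        f (x k) + η k - γ * (2 * α k) ^ 2 * (f (x k) - ftarget))
    (hmono : ∀ k, f (x (k + 1)) ≤ f (x k + α k • d k))
    (htarget : ∀ k, ftarget < f (x k)) :
    Tendsto α atTop (𝓝 0) ∨
      ∃ φ : ℕ → ℕ, StrictMono φ ∧
        Tendsto (fun j => f (x (φ j))) atTop (𝓝 ftarget) := by
  obtain ⟨hγ0, -⟩ := hγ
  have hsum : Summable fun k => γ * (α k) ^ 2 * (f (x k) - ftarget) := by
    refine summable_of_le_add_sub (g := fun k => f (x k) - ftarget)
      (fun k => (sub_pos.2 (htarget k)).le) (fun k => (hηpos k).le) hηsum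
      (fun k => ?_) fun k => ?_
    · have := sub_pos.2 (htarget k)
      positivity
    · linarith [hdec k, hmono k]
  by_cases hc : MapClusterPt ftarget atTop fun k => f (x k)
  · exact Or.inr hc.tendsto_subseq
  · left
    rw [Metric.nhds_basis_ball.mapClusterPt_iff_frequently] at hc
    push Not at hc
    obtain ⟨ε, hε, hev⟩ := hc
    have hsq : Tendsto (fun k => (α k) ^ 2) atTop (𝓝 0) := by
      have hlim := hsum.tendsto_atTop_zero.div_const (γ * ε)
      rw [zero_div] at hlim
      refine squeeze_zero' (Eventually.of_forall fun k => sq_nonneg _) ?_ hlim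
      filter_upwards [hev] with k hk
      have hgap : ε ≤ f (x k) - ftarget := by
        rw [Metric.mem_ball, Real.dist_eq, abs_of_pos (sub_pos.2 (htarget k))] at hk
        exact not_lt.1 hk
      rw [le_div_iff₀ (by positivity)]
      calc (α k) ^ 2 * (γ * ε) = γ * (α k) ^ 2 * ε := by ring
        _ ≤ γ * (α k) ^ 2 * (f (x k) - ftarget) := by gcongr
    have hsqrt := hsq.sqrt
    rw [Real.sqrt_zero] at hsqrt
    exact hsqrt.congr fun k => Real.sqrt_sq (hα k).1.le
end

section
/- Assume f is continuously differentiable on an open set containing Ω, (x^k, d^k, α_k) is an Algorithm-2.1 sequence, there exists ρ > 0 such that f(x^k) − f_target ≥ ρ for all k ∈ ℕ, and there exist x_* ∈ ℝⁿ and an infinite set of indices K₁ ⊆ ℕ such that x^k → x_* as k → ∞ along K₁. Then the sequence (d^k)_{k ∈ K₁} has at least one limit point, and every limit point d of (d^k)_{k ∈ K₁} satisfies ⟨∇f(x_*), d⟩ ≥ 0. -/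
open Filter Topology InnerProductSpace

/-- A nonnegative sequence whose multiples are dominated by the decrease of a bounded-below sequence,
up to a summable error, is summable. -/
theorem summable_of_le_sub_add {u v η : ℕ → ℝ} {b c : ℝ} (hc : 0 < c) (hv : ∀ k, 0 ≤ v k)
    (hu : ∀ k, b ≤ u k) (hη : ∀ k, 0 ≤ η k) (hηsum : Summable η)
    (h : ∀ k, c * v k ≤ u k - u (k + 1) + η k) : Summable v := by
  have hsum : Summable fun k => c * v k := by
    refine summable_of_sum_range_le (c := u 0 - b + ∑' k, η k)
      (fun k => mul_nonneg hc.le (hv k)) fun m => ?_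
    calc ∑ k ∈ Finset.range m, c * v k
        ≤ ∑ k ∈ Finset.range m, (u k - u (k + 1) + η k) := Finset.sum_le_sum fun k _ => h k
      _ = u 0 - u m + ∑ k ∈ Finset.range m, η k := by
          rw [Finset.sum_add_distrib, Finset.sum_range_sub']
      _ ≤ u 0 - b + ∑' k, η k := by
          have := hηsum.sum_le_tsum (Finset.range m) fun k _ => hη k
          linarith [hu m]
  exact (summable_mul_left_iff hc.ne').1 hsum

/-- If the difference quotients of `f` at points tending to `a`, with bounded directions and vanishing
steps, are bounded below by a sequence tending to zero, then the derivative of `f` at `a` is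
nonnegative at every cluster point of the directions. -/
theorem HasStrictFDerivAt.nonneg_of_mapClusterPt {E ι : Type*} [NormedAddCommGroup E]
    [NormedSpace ℝ E] {f : E → ℝ} {f' : E →L[ℝ] ℝ} {a v : E} (hf : HasStrictFDerivAt f f' a)
    {l : Filter ι} {x d : ι → E} {t s : ι → ℝ} {C : ℝ} (hx : Tendsto x l (𝓝 a))
    (hd : ∀ i, ‖d i‖ ≤ C) (htpos : ∀ i, 0 < t i) (ht : Tendsto t l (𝓝 0))
    (hs : Tendsto s l (𝓝 0)) (h : ∀ᶠ i in l, t i * s i ≤ f (x i + t i • d i) - f (x i))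
    (hv : MapClusterPt v l d) : 0 ≤ f' v := by
  by_contra! hneg
  have htd : Tendsto (fun i => t i • d i) l (𝓝 0) :=
    ht.zero_smul_isBoundedUnder_le (isBoundedUnder_of ⟨C, hd⟩)
  have hy : Tendsto (fun i => x i + t i • d i) l (𝓝 a) := by simpa using hx.add htd
  set ε := -(f' v) / 4 with hε
  have hεpos : 0 < ε := by linarith
  have hC : 0 < |C| + 1 := by positivity
  have hlit := (hf.isLittleO.comp_tendsto (hy.prodMk_nhds hx)).def (div_pos hεpos hC)
  have hfreq : ∃ᶠ i in l, f' (d i) < -(2 * ε) :=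
    hv.frequently ((f'.continuous.tendsto v).eventually_lt_const (by linarith))
  obtain ⟨i, hi, hlit, hsi, hq⟩ := (hfreq.and_eventually
    (hlit.and ((hs.eventually_const_lt (neg_neg_of_pos hεpos)).and h))).exists
  have hti := htpos i
  simp only [Function.comp_apply, add_sub_cancel_left, map_smul, smul_eq_mul, norm_smul,
    Real.norm_eq_abs, _root_.abs_of_pos hti] at hlit
  have hbound : ε / (|C| + 1) * (t i * ‖d i‖) ≤ t i * ε := by
    have hdi : ‖d i‖ ≤ |C| + 1 := by linarith [hd i, le_abs_self C]
    calc ε / (|C| + 1) * (t i * ‖d i‖) ≤ ε / (|C| + 1) * (t i * (|C| + 1)) := by gcongr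
      _ = t i * ε := by field_simp
  have hup := (le_abs_self _).trans (hlit.trans hbound)
  have : t i * (s i + ε) < 0 := by nlinarith
  exact absurd this (not_lt.2 (mul_nonneg hti.le (by linarith)))

/-- Lemma 2.3: if `f` is continuously differentiable on an open set containing
`Ω`, the values `f(xᵏ) − f_target` are bounded away from zero, and `xᵏ → x∗`
along an infinite index set `K₁`, then the directions `dᵏ`, `k ∈ K₁`, admit at
least one limit point, and every such limit point `d` satisfies
`⟨∇f(x∗), d⟩ ≥ 0`. -/
theorem alg21_limit_directions_nonneg_inner
    (n : ℕ) (Ω : Set (EuclideanSpace ℝ (Fin n))) (hΩc : IsClosed Ω) (hΩconv : Convex ℝ Ω)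
    (f : EuclideanSpace ℝ (Fin n) → ℝ)
    (ftarget Δ γ : ℝ) (hΔ : 0 < Δ) (hγ : γ ∈ Set.Ioo (0 : ℝ) 1)
    (η : ℕ → ℝ) (hηpos : ∀ k, 0 < η k) (hηsum : Summable η)
    (x d : ℕ → EuclideanSpace ℝ (Fin n)) (α : ℕ → ℝ)
    (hxΩ : ∀ k, x k ∈ Ω)
    (hd : ∀ k, ‖d k‖ ≤ Δ) (hdΩ : ∀ k, x k + d k ∈ Ω)
    (hα : ∀ k, α k ∈ Set.Ioc (0 : ℝ) 1)
    (hdec : ∀ k, f (x k + α k • d k) ≤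
      f (x k) + η k - γ * (α k) ^ 2 * (f (x k) - ftarget))
    (hrej : ∀ k, α k = 1 ∨
      f (x k + (2 * α k) • d k) >
        f (x k) + η k - γ * (2 * α k) ^ 2 * (f (x k) - ftarget))
    (hmono : ∀ k, f (x (k + 1)) ≤ f (x k + α k • d k))
    (U : Set (EuclideanSpace ℝ (Fin n))) (hU : IsOpen U) (hΩU : Ω ⊆ U)
    (hf : ContDiffOn ℝ 1 f U)
    (hbdd : ∃ ρ > 0, ∀ k, ρ ≤ f (x k) - ftarget)
    (xstar : EuclideanSpace ℝ (Fin n)) (K : Set ℕ) (hK : K.Infinite)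
    (hxconv : Tendsto x (atTop ⊓ 𝓟 K) (𝓝 xstar)) :
    (∃ dlim, MapClusterPt dlim (atTop ⊓ 𝓟 K) d) ∧
      ∀ dlim, MapClusterPt dlim (atTop ⊓ 𝓟 K) d →
        0 ≤ ⟪ gradient f xstar, dlim ⟫_ℝ := by
  obtain ⟨ρ, hρ, hgap⟩ := hbdd
  have hKne : NeBot (atTop ⊓ 𝓟 K) :=
    frequently_mem_iff_neBot.1 (Nat.frequently_atTop_iff_infinite.2 hK)
  refine ⟨?_, fun dlim hdlim => ?_⟩
  · obtain ⟨v, -, hv⟩ := (isCompact_closedBall (0 : EuclideanSpace ℝ (Fin n)) Δ).exists_mapClusterPt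
      (f := atTop ⊓ 𝓟 K) (u := d) (tendsto_principal.2 (Eventually.of_forall fun k => by simpa using hd k))
    exact ⟨v, hv⟩
  have hαsq : Summable fun k => α k ^ 2 := by
    refine summable_of_le_sub_add (u := fun k => f (x k)) (b := ftarget) (mul_pos hγ.1 hρ)
      (fun k => sq_nonneg _) (fun k => by linarith [hgap k]) (fun k => (hηpos k).le) hηsum fun k => ?_
    have := mul_le_mul_of_nonneg_left (hgap k) (mul_nonneg hγ.1.le (sq_nonneg (α k)))
    linarith [hdec k, hmono k]
  have hα0 : Tendsto α atTop (𝓝 0) := by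
    simpa [Real.sqrt_sq (hα _).1.le] using hαsq.tendsto_atTop_zero.sqrt
  have hαK : Tendsto α (atTop ⊓ 𝓟 K) (𝓝 0) := hα0.mono_left inf_le_left
  have hxs : xstar ∈ U := hΩU (hΩc.mem_of_tendsto hxconv (Eventually.of_forall hxΩ))
  have hfs : HasStrictFDerivAt f (fderiv ℝ f xstar) xstar :=
    (hf.contDiffAt (hU.mem_nhds hxs)).hasStrictFDerivAt one_ne_zero
  have hfx : Tendsto (fun k => f (x k)) (atTop ⊓ 𝓟 K) (𝓝 (f xstar)) :=
    hfs.continuousAt.tendsto.comp hxconv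
  have ht : Tendsto (fun k => 2 * α k) (atTop ⊓ 𝓟 K) (𝓝 0) := by simpa using hαK.const_mul 2
  have hs : Tendsto (fun k => -(γ * (2 * α k) * (f (x k) - ftarget))) (atTop ⊓ 𝓟 K) (𝓝 0) := by
    simpa using ((ht.const_mul γ).mul (hfx.sub_const ftarget)).neg
  rw [gradient, toDual_symm_apply]
  refine hfs.nonneg_of_mapClusterPt hxconv hd (fun k => mul_pos two_pos (hα k).1) ht hs ?_ hdlim
  filter_upwards [hαK.eventually_lt_const one_pos] with k hk
  have := (hrej k).resolve_left hk.ne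
  linarith [hηpos k]
end

section
/- Assume f is continuously differentiable on an open set containing Ω, (x^k, d^k, α_k) is an Algorithm-2.1 sequence in which, for each k, there is a unit vector v^k ∈ ℝⁿ (‖v^k‖ = 1) such that d^k minimizes ⟨v^k, d⟩ over the set {d ∈ ℝⁿ : ‖d‖ ≤ Δ and x^k + d ∈ Ω}. Suppose there exists ρ > 0 with f(x^k) − f_target ≥ ρ for all k ∈ ℕ, and there exist x_* ∈ ℝⁿ and an infinite set of indices K₁ ⊆ ℕ such that x^k → x_* along K₁, ∇f(x^k) ≠ 0 for k ∈ K₁, and ‖v^k − ∇f(x^k)/‖∇f(x^k)‖‖ → 0 along K₁. Then for every d ∈ ℝⁿ with ‖d‖ ≤ Δ and x_* + d ∈ Ω, one has ⟨∇f(x_*), d⟩ ≥ 0. -/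
open Filter Topology InnerProductSpace

/-- Telescoping a decrease recursion with summable errors. -/
lemma add_sum_range_le_add_tsum {a b η : ℕ → ℝ} (hη : ∀ k, 0 ≤ η k) (hηs : Summable η)
    (h : ∀ k, a (k + 1) ≤ a k + η k - b k) (m : ℕ) :
    a m + ∑ k ∈ Finset.range m, b k ≤ a 0 + ∑' k, η k := by
  have key : a m + ∑ k ∈ Finset.range m, b k ≤ a 0 + ∑ k ∈ Finset.range m, η k := by
    induction m with
    | zero => simp
    | succ m ih =>
      rw [Finset.sum_range_succ, Finset.sum_range_succ]
      linarith [h m]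
  linarith [hηs.sum_le_tsum (Finset.range m) fun k _ => hη k]

/-- If bounded directions admit vanishing steps along which `f` decreases at most quadratically in
the step size, then they are asymptotically bounded below by a null sequence against the gradient
at the limit point. -/
lemma exists_tendsto_zero_le_inner_gradient {ι E : Type*} [NormedAddCommGroup E]
    [InnerProductSpace ℝ E] [CompleteSpace E] {f : E → ℝ} {l : Filter ι} {x d : ι → E}
    {t : ι → ℝ} {xs : E} {Δ C : ℝ} (hf : ContDiffAt ℝ 1 f xs) (hx : Tendsto x l (𝓝 xs))
    (hd : ∀ k, ‖d k‖ ≤ Δ) (ht : Tendsto t l (𝓝 0)) (htpos : ∀ k, 0 < t k)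
    (hstep : ∀ᶠ k in l, f (x k) - C * t k ^ 2 ≤ f (x k + t k • d k)) :
    ∃ e : ι → ℝ, Tendsto e l (𝓝 0) ∧ ∀ᶠ k in l, e k ≤ ⟪gradient f xs, d k⟫_ℝ := by
  have hstrict := hf.hasStrictFDerivAt one_ne_zero
  have hbdd : (fun k => t k • d k) =O[l] t := by
    refine Asymptotics.IsBigO.of_bound Δ (Eventually.of_forall fun k => ?_)
    rw [norm_smul, mul_comm]
    exact mul_le_mul_of_nonneg_right (hd k) (norm_nonneg _)
  have htd : Tendsto (fun k => t k • d k) l (𝓝 0) := hbdd.trans_tendsto ht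
  have hpair : Tendsto (fun k => (x k + t k • d k, x k)) l (𝓝 (xs, xs)) := by
    have h := hx.add htd
    rw [add_zero] at h
    exact h.prodMk_nhds hx
  have ho := hstrict.isLittleO.comp_tendsto hpair
  have ho' : (fun k => f (x k + t k • d k) - f (x k) - fderiv ℝ f xs (t k • d k)) =o[l] t := by
    refine Asymptotics.IsLittleO.trans_isBigO ?_ hbdd
    simpa [Function.comp_def] using ho
  refine ⟨fun k => -(C * t k) -
    (f (x k + t k • d k) - f (x k) - fderiv ℝ f xs (t k • d k)) / t k, ?_, ?_⟩
  · simpa using (ht.const_mul C).neg.sub ho'.tendsto_div_nhds_zero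
  · filter_upwards [hstep] with k hk
    have hg : ⟪gradient f xs, d k⟫_ℝ = fderiv ℝ f xs (d k) := by
      simp [gradient]
    rw [hg, map_smul, smul_eq_mul, sub_le_iff_le_add, ← sub_le_iff_le_add',
      le_div_iff₀ (htpos k)]
    nlinarith

/-- Lemma 2.4: for an Algorithm-2.1 sequence in which each `dᵏ` minimizes
`⟨vᵏ, d⟩` over `{d : ‖d‖ ≤ Δ, xᵏ + d ∈ Ω}` for unit vectors `vᵏ`, if
`f(xᵏ) − f_target` is bounded away from zero, `xᵏ → x∗` along an infinite
index set `K₁`, and `vᵏ` approaches the normalized gradient along `K₁`, then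
`⟨∇f(x∗), d⟩ ≥ 0` for every feasible direction `d` at `x∗`. -/
theorem alg21_stationarity_at_limit
    (n : ℕ) (Ω : Set (EuclideanSpace ℝ (Fin n))) (hΩc : IsClosed Ω) (hΩconv : Convex ℝ Ω)
    (f : EuclideanSpace ℝ (Fin n) → ℝ)
    (ftarget Δ γ : ℝ) (hΔ : 0 < Δ) (hγ : γ ∈ Set.Ioo (0 : ℝ) 1)
    (η : ℕ → ℝ) (hηpos : ∀ k, 0 < η k) (hηsum : Summable η)
    (x d : ℕ → EuclideanSpace ℝ (Fin n)) (α : ℕ → ℝ)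
    (hxΩ : ∀ k, x k ∈ Ω)
    (hd : ∀ k, ‖d k‖ ≤ Δ) (hdΩ : ∀ k, x k + d k ∈ Ω)
    (hα : ∀ k, α k ∈ Set.Ioc (0 : ℝ) 1)
    (hdec : ∀ k, f (x k + α k • d k) ≤
      f (x k) + η k - γ * (α k) ^ 2 * (f (x k) - ftarget))
    (hrej : ∀ k, α k = 1 ∨
      f (x k + (2 * α k) • d k) >
        f (x k) + η k - γ * (2 * α k) ^ 2 * (f (x k) - ftarget))
    (hmono : ∀ k, f (x (k + 1)) ≤ f (x k + α k • d k))
    (U : Set (EuclideanSpace ℝ (Fin n))) (hU : IsOpen U) (hΩU : Ω ⊆ U)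
    (hf : ContDiffOn ℝ 1 f U)
    (v : ℕ → EuclideanSpace ℝ (Fin n)) (hv : ∀ k, ‖v k‖ = 1)
    (hdmin : ∀ k, ∀ d' : EuclideanSpace ℝ (Fin n), ‖d'‖ ≤ Δ → x k + d' ∈ Ω →
      ⟪ v k, d k ⟫_ℝ ≤ ⟪ v k, d' ⟫_ℝ)
    (hbdd : ∃ ρ > 0, ∀ k, ρ ≤ f (x k) - ftarget)
    (xstar : EuclideanSpace ℝ (Fin n)) (K : Set ℕ) (hK : K.Infinite)
    (hxconv : Tendsto x (atTop ⊓ 𝓟 K) (𝓝 xstar))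
    (hgrad : ∀ k ∈ K, gradient f (x k) ≠ 0)
    (hvconv : Tendsto (fun k => ‖v k - ‖gradient f (x k)‖⁻¹ • gradient f (x k)‖)
      (atTop ⊓ 𝓟 K) (𝓝 0)) :
    ∀ dd : EuclideanSpace ℝ (Fin n), ‖dd‖ ≤ Δ → xstar + dd ∈ Ω →
      0 ≤ ⟪ gradient f xstar, dd ⟫_ℝ := by
  obtain ⟨ρ, hρ, hgap⟩ := hbdd
  intro dd hdd hddΩ
  have hnebot : (atTop ⊓ 𝓟 K : Filter ℕ).NeBot := by
    rw [← frequently_mem_iff_neBot]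
    exact Nat.frequently_atTop_iff_infinite.2 hK
  have hxs : xstar ∈ Ω := hΩc.mem_of_tendsto hxconv (Eventually.of_forall hxΩ)
  have hfs : ContDiffAt ℝ 1 f xstar := hf.contDiffAt (hU.mem_nhds (hΩU hxs))
  have hgradcont : Tendsto (fun k => gradient f (x k)) (atTop ⊓ 𝓟 K) (𝓝 (gradient f xstar)) :=
    ((toDual ℝ (EuclideanSpace ℝ (Fin n))).symm.continuous.tendsto _).comp
      ((hfs.continuousAt_fderiv one_ne_zero).tendsto.comp hxconv)
  have hrec : ∀ k, f (x (k + 1)) ≤ f (x k) + η k - γ * ρ * α k ^ 2 := fun k => by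
    have h := mul_le_mul_of_nonneg_left (hgap k) (mul_nonneg hγ.1.le (sq_nonneg (α k)))
    linarith [hmono k, hdec k]
  have hnonneg : ∀ k, 0 ≤ γ * ρ * α k ^ 2 := fun k =>
    mul_nonneg (mul_pos hγ.1 hρ).le (sq_nonneg _)
  have htel := add_sum_range_le_add_tsum (a := fun k => f (x k)) (fun k => (hηpos k).le) hηsum hrec
  have hαsum : Summable fun k => γ * ρ * α k ^ 2 :=
    summable_of_sum_range_le (c := f (x 0) + ∑' k, η k - ftarget - ρ) hnonneg fun m => by
      linarith [htel m, hgap m]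
  have hα0 : Tendsto α atTop (𝓝 0) := by
    have h : Tendsto (fun k => α k ^ 2) atTop (𝓝 0) := by
      simpa [← mul_assoc, hρ.ne', hγ.1.ne'] using
        ((summable_mul_left_iff (mul_pos hγ.1 hρ).ne').1 hαsum).tendsto_atTop_zero
    simpa [Real.sqrt_sq (hα _).1.le] using h.sqrt
  set C := γ * (f (x 0) + ∑' k, η k - ftarget)
  have hstep : ∀ᶠ k in atTop ⊓ 𝓟 K, f (x k) - C * (2 * α k) ^ 2 ≤ f (x k + (2 * α k) • d k) := by
    filter_upwards [(hα0.mono_left inf_le_left).eventually_lt_const one_pos] with k hk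
    have h := (hrej k).resolve_left hk.ne
    have hub : f (x k) - ftarget ≤ f (x 0) + ∑' k, η k - ftarget := by
      linarith [htel k, Finset.sum_nonneg fun i (_ : i ∈ Finset.range k) => hnonneg i]
    have := mul_le_mul_of_nonneg_left hub (mul_nonneg hγ.1.le (sq_nonneg (2 * α k)))
    simp only [C]
    linarith [hηpos k]
  obtain ⟨e, he, hle⟩ := exists_tendsto_zero_le_inner_gradient hfs hxconv hd
    (by simpa using (hα0.mono_left inf_le_left).const_mul 2)
    (fun k => mul_pos two_pos (hα k).1) hstep
  rcases eq_or_ne (gradient f xstar) 0 with hg | hg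
  · simp [hg]
  set g := gradient f xstar
  have hvu : Tendsto v (atTop ⊓ 𝓟 K) (𝓝 (‖g‖⁻¹ • g)) := by
    have h := (tendsto_zero_iff_norm_tendsto_zero.2 hvconv).add
      ((hgradcont.norm.inv₀ (norm_ne_zero_iff.2 hg)).smul hgradcont)
    simpa using h
  have hgu : ‖g‖ • ‖g‖⁻¹ • g = g := smul_inv_smul₀ (norm_ne_zero_iff.2 hg) g
  have hdiff : Tendsto (fun k => xstar + dd - x k) (atTop ⊓ 𝓟 K) (𝓝 dd) := by
    simpa using hxconv.const_sub (xstar + dd)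
  have hfeas : ∀ᶠ k in atTop ⊓ 𝓟 K, ‖xstar + dd - x k‖ < 2 * Δ :=
    hdiff.norm.eventually_lt_const (by linarith)
  have hupper : ∀ᶠ k in atTop ⊓ 𝓟 K, ⟪g, d k⟫_ℝ ≤
      ‖g - ‖g‖ • v k‖ * Δ + ‖g‖ * (2⁻¹ * ⟪v k, xstar + dd - x k⟫_ℝ) := by
    filter_upwards [hfeas] with k hk
    have h1 := hdmin k ((2⁻¹ : ℝ) • (xstar + dd - x k))
      (by rw [norm_smul]; norm_num; linarith)
      (hΩconv.add_smul_sub_mem (hxΩ k) hddΩ ⟨by norm_num, by norm_num⟩)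
    rw [real_inner_smul_right] at h1
    have h2 := (real_inner_le_norm (g - ‖g‖ • v k) (d k)).trans
      (mul_le_mul_of_nonneg_left (hd k) (norm_nonneg _))
    rw [inner_sub_left, real_inner_smul_left] at h2
    linarith [mul_le_mul_of_nonneg_left h1 (norm_nonneg g)]
  have hlim : Tendsto (fun k => ‖g - ‖g‖ • v k‖ * Δ +
      ‖g‖ * (2⁻¹ * ⟪v k, xstar + dd - x k⟫_ℝ)) (atTop ⊓ 𝓟 K) (𝓝 (2⁻¹ * ⟪g, dd⟫_ℝ)) := by
    have h := ((((hvu.const_smul ‖g‖).const_sub g).norm).mul_const Δ).add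
      (((hvu.inner (𝕜 := ℝ) hdiff).const_mul (2⁻¹ : ℝ)).const_mul ‖g‖)
    rw [hgu, sub_self, norm_zero, zero_mul, zero_add, mul_left_comm, ← real_inner_smul_left,
      hgu] at h
    exact h
  have := le_of_tendsto_of_tendsto he hlim (hle.and hupper |>.mono fun k hk => hk.1.trans hk.2)
  linarith
end
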